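/- Let p ≥ 2 be an integer and let M be an abelian group equipped with an internal direct sum decomposition M = ⊕_{n ∈ ℤ} M_n into additive subgroups. Let f : M → M be an additive map such that f(M_n) ⊆ M_{p·n} for every n ∈ ℤ. Then the stable part ⋂_{i ≥ 1} f^i(M) is contained in the degree-0 component M_0. -/

import Mathlib

/-- If `f` multiplies degrees by `p`, then `f^[i]` multiplies degrees by `p ^ i`. -/
theorem iterate_mem_of_mul_degree {M : Type*} [AddCommGroup M] {p : ℤ} {ℳ : ℤ → AddSubgroup M}
    {f : M → M} (hgr : ∀ (n : ℤ), ∀ x ∈ ℳ n, f x ∈ ℳ (p * n)) (i : ℕ) {n : ℤ} {x : M}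
    (hx : x ∈ ℳ n) : f^[i] x ∈ ℳ (p ^ i * n) := by
  induction i with
  | zero => simpa using hx
  | succ i ih =>
    rw [Function.iterate_succ_apply', pow_succ', mul_assoc]
    exact hgr _ _ ih

/-- If an additive map `g` multiplies degrees by `q`, then the homogeneous components of `g y`
vanish in degrees not divisible by `q`. -/
theorem decompose_apply_eq_zero_of_not_dvd {M : Type*} [AddCommGroup M] {q : ℤ}
    {ℳ : ℤ → AddSubgroup M} [DirectSum.Decomposition ℳ] (g : M →+ M)
    (hg : ∀ (n : ℤ), ∀ x ∈ ℳ n, g x ∈ ℳ (q * n)) {n : ℤ} (hn : ¬ q ∣ n) (y : M) :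
    (DirectSum.decompose ℳ (g y) n : M) = 0 := by
  induction y using DirectSum.Decomposition.inductionOn ℳ with
  | zero => simp
  | @homogeneous m y =>
    exact DirectSum.decompose_of_mem_ne ℳ (hg m y y.2) fun h => hn ⟨m, h.symm⟩
  | add y z hy hz => simp [DirectSum.decompose_add, hy, hz]

/-- Let `p ≥ 2` be an integer and `M` an abelian group with an internal direct sum
decomposition `M = ⊕_{n ∈ ℤ} M_n` into additive subgroups. Let `f : M → M` be an
additive map with `f(M_n) ⊆ M_{p·n}` for all `n`. Then the stable part
`⋂_{i ≥ 1} f^i(M)` is contained in the degree-`0` component `M₀`. -/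
theorem stable_part_subset_degree_zero
    (M : Type*) [AddCommGroup M]
    (p : ℤ) (hp : 2 ≤ p)
    (ℳ : ℤ → AddSubgroup M) (hdec : DirectSum.IsInternal ℳ)
    (f : M → M)
    (hadd : ∀ x y : M, f (x + y) = f x + f y)
    (hgr : ∀ (n : ℤ), ∀ x ∈ ℳ n, f x ∈ ℳ (p * n)) :
    (⋂ i ≥ 1, Set.range (f^[i])) ⊆ (ℳ 0 : Set M) := by
  classical
  intro x hx
  simp only [Set.mem_iInter, Set.mem_range] at hx
  let := hdec.chooseDecomposition
  rw [SetLike.mem_coe, ← DirectSum.sum_support_decompose ℳ x]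
  refine sum_mem fun n _ => ?_
  obtain rfl | hn := eq_or_ne n 0
  · exact SetLike.coe_mem _
  · obtain ⟨k, hk⟩ : FiniteMultiplicity p n := Int.finiteMultiplicity_iff.2 ⟨by omega, hn⟩
    obtain ⟨y, rfl⟩ := hx (k + 1) (by omega)
    let g : M →+ M :=
      AddMonoidHom.mk' f^[k + 1] (iterate_map_add (AddMonoidHom.mk' f hadd) (k + 1))
    have hy : (DirectSum.decompose ℳ (f^[k + 1] y) n : M) = 0 :=
      decompose_apply_eq_zero_of_not_dvd (ℳ := ℳ) g (fun _ _ => iterate_mem_of_mul_degree hgr _) hk y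
    exact hy ▸ zero_mem _
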